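/- The Lie derivative commutes with the de Rham differential: for every vector field V : Fin n → Λ on ℝ^{0|n} of Grassmann parity p (all components V α in the evenOdd (p+1) part of Λ), one has V^↑ ∘ Q = (-1)^p · Q ∘ V^↑ as linear endomorphisms of P; equivalently the supercommutator [V^↑, Q] vanishes. -/

import Mathlib

open TensorProduct

noncomputable section

/-- The Grassmann algebra on `n` odd generators `ξ^α`. -/
abbrev Lam (n : ℕ) : Type := ExteriorAlgebra ℝ (Fin n → ℝ)

/-- The odd coordinate `ξ^α`, i.e. the generator `e_α = ι (Pi.single α 1)`. -/
def gen {n : ℕ} (α : Fin n) : Lam n := ExteriorAlgebra.ι ℝ (Pi.single α 1)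

/-- The odd partial derivative `∂/∂ξ^α`: left contraction with the `α`-th
coordinate functional, the unique antiderivation sending `e_β` to `δ_{αβ}`. -/
def pd {n : ℕ} (α : Fin n) : Lam n →ₗ[ℝ] Lam n :=
  CliffordAlgebra.contractLeft (Q := (0 : QuadraticForm ℝ (Fin n → ℝ))) (LinearMap.proj α)

/-- The algebra of (pseudo)differential forms on `ℝ^{0|n}`:
polynomials in the even fiber coordinates `y^α` with Grassmann coefficients. -/
abbrev Forms (n : ℕ) : Type := MvPolynomial (Fin n) ℝ ⊗[ℝ] Lam n

/-- The de Rham differential `Q = y^α ∂_{ξ^α}`. -/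
def deRham (n : ℕ) : Forms n →ₗ[ℝ] Forms n :=
  ∑ α : Fin n, TensorProduct.map (LinearMap.mulLeft ℝ (MvPolynomial.X α)) (pd α)


/-- The inner product `i_V = V^α ∂_{y^α}` of the vector field `V = V^α ∂_{ξ^α}`. -/
def innerProd {n : ℕ} (V : Fin n → Lam n) : Forms n →ₗ[ℝ] Forms n :=
  ∑ α : Fin n, TensorProduct.map (MvPolynomial.pderiv α).toLinearMap
    (LinearMap.mulLeft ℝ (V α))

/-- The Lie derivative `L_V = V^α ∂_{ξ^α} + (-1)^p Q(V^α) ∂_{y^α}` of a vector field of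
Grassmann parity `p`. -/
def lieDer {n : ℕ} (p : ZMod 2) (V : Fin n → Lam n) : Forms n →ₗ[ℝ] Forms n :=
  (∑ α : Fin n, TensorProduct.map LinearMap.id (LinearMap.mulLeft ℝ (V α) ∘ₗ pd α)) +
  (-1 : ℝ) ^ p.val •
    ∑ α : Fin n, ∑ β : Fin n, TensorProduct.map
      (LinearMap.mulLeft ℝ (MvPolynomial.X β) ∘ₗ (MvPolynomial.pderiv α).toLinearMap)
      (LinearMap.mulLeft ℝ (pd β (V α)))

section Contraction

open CliffordAlgebra

variable {R M : Type*} [CommRing R] [AddCommGroup M] [Module R M] {q : QuadraticForm R M}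

/-- Left contraction is an antiderivation of the Clifford algebra. -/
theorem contractLeft_mul (d : Module.Dual R M) (a b : CliffordAlgebra q) :
    contractLeft d (a * b) = contractLeft d a * b + involute a * contractLeft d b := by
  induction a using CliffordAlgebra.left_induction with
  | algebraMap r =>
    rw [contractLeft_algebraMap_mul, contractLeft_algebraMap, AlgHom.commutes, zero_mul, zero_add]
  | add x y hx hy => simp only [add_mul, map_add, hx, hy]; abel
  | ι_mul x m hx =>
    rw [mul_assoc, contractLeft_ι_mul, contractLeft_ι_mul, hx, map_mul, involute_ι]
    simp only [mul_add, sub_mul, neg_mul, smul_mul_assoc, mul_assoc]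
    abel

/-- Left contraction anticommutes with the grade involution. -/
theorem involute_contractLeft (d : Module.Dual R M) (a : CliffordAlgebra q) :
    involute (contractLeft d a) = -contractLeft d (involute a) := by
  induction a using CliffordAlgebra.left_induction with
  | algebraMap r => simp
  | add x y hx hy => simp only [map_add, hx, hy]; abel
  | ι_mul x m hx =>
    rw [contractLeft_ι_mul, map_sub, map_smul, map_mul, map_mul, involute_ι, hx, neg_mul, mul_neg,
      neg_mul, neg_neg, map_neg, contractLeft_ι_mul, neg_neg]

/-- The grade involution acts by the sign `-(-1)^p` on elements of parity `p + 1`. -/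
theorem involute_eq_of_mem_evenOdd_add_one {p : ZMod 2} {a : CliffordAlgebra q}
    (ha : a ∈ evenOdd q (p + 1)) : involute a = -((-1 : R) ^ p.val • a) := by
  fin_cases p
  · simpa [ZMod.val] using involute_eq_of_mem_odd (by exact ha)
  · simpa [ZMod.val] using involute_eq_of_mem_even (by exact ha)

end Contraction

theorem pd_pd_comm {n : ℕ} (α β : Fin n) (x : Lam n) : pd α (pd β x) = -pd β (pd α x) :=
  CliffordAlgebra.contractLeft_comm _ _ _

theorem pd_mul_of_mem_evenOdd {n : ℕ} {p : ZMod 2} {v : Lam n}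
    (hv : v ∈ CliffordAlgebra.evenOdd (0 : QuadraticForm ℝ (Fin n → ℝ)) (p + 1))
    (α : Fin n) (x : Lam n) :
    pd α (v * x) = pd α v * x - (-1 : ℝ) ^ p.val • (v * pd α x) := by
  refine (contractLeft_mul _ _ _).trans ?_
  rw [involute_eq_of_mem_evenOdd_add_one hv, neg_mul, smul_mul_assoc, ← sub_eq_add_neg]
  rfl

theorem pd_pd_mul_of_mem_evenOdd {n : ℕ} {p : ZMod 2} {v : Lam n}
    (hv : v ∈ CliffordAlgebra.evenOdd (0 : QuadraticForm ℝ (Fin n → ℝ)) (p + 1))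
    (α β : Fin n) (x : Lam n) :
    pd α (pd β v * x) = pd α (pd β v) * x + (-1 : ℝ) ^ p.val • (pd β v * pd α x) := by
  refine (contractLeft_mul _ _ _).trans ?_
  have h : CliffordAlgebra.involute (pd β v) = (-1 : ℝ) ^ p.val • pd β v := by
    refine (involute_contractLeft _ _).trans ?_
    rw [involute_eq_of_mem_evenOdd_add_one hv, map_neg, neg_neg, map_smul]
    rfl
  rw [h, smul_mul_assoc]
  rfl

theorem deRham_tmul {n : ℕ} (f : MvPolynomial (Fin n) ℝ) (x : Lam n) :
    deRham n (f ⊗ₜ[ℝ] x) = ∑ γ, (MvPolynomial.X γ * f) ⊗ₜ[ℝ] pd γ x := by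
  simp [deRham, LinearMap.sum_apply]

theorem lieDer_tmul {n : ℕ} (p : ZMod 2) (V : Fin n → Lam n) (f : MvPolynomial (Fin n) ℝ)
    (x : Lam n) :
    lieDer p V (f ⊗ₜ[ℝ] x) = ∑ α, f ⊗ₜ[ℝ] (V α * pd α x) +
      (-1 : ℝ) ^ p.val • ∑ α, ∑ β,
        (MvPolynomial.X β * MvPolynomial.pderiv α f) ⊗ₜ[ℝ] (pd β (V α) * x) := by
  simp [lieDer, LinearMap.sum_apply]

/-- Symmetric products of the even coordinates kill second odd partial derivatives. -/
theorem sum_X_mul_X_tmul_pd_pd_mul {n : ℕ} (f : MvPolynomial (Fin n) ℝ) (v x : Lam n) :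
    ∑ β, ∑ γ, (MvPolynomial.X γ * (MvPolynomial.X β * f)) ⊗ₜ[ℝ] (pd γ (pd β v) * x) = 0 := by
  refine (smul_eq_zero_iff_right (two_ne_zero (α := ℝ))).mp ?_
  rw [two_smul, add_eq_zero_iff_eq_neg]
  conv_lhs => rw [Finset.sum_comm]
  simp only [← Finset.sum_neg_distrib]
  refine Finset.sum_congr rfl fun β _ => Finset.sum_congr rfl fun γ _ => ?_
  rw [pd_pd_comm, neg_mul, TensorProduct.tmul_neg, mul_left_comm]

/-- The Lie derivative supercommutes with the de Rham differential: for a vector field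
`V` of Grassmann parity `p`, `V^↑ ∘ Q = (-1)^p Q ∘ V^↑`, i.e. `[V^↑, Q] = 0`. -/
theorem lieDer_comm_deRham (n : ℕ) (hn : 1 ≤ n) (p : ZMod 2) (V : Fin n → Lam n)
    (hV : ∀ α, V α ∈ CliffordAlgebra.evenOdd (0 : QuadraticForm ℝ (Fin n → ℝ)) (p + 1)) :
    lieDer p V ∘ₗ deRham n = (-1 : ℝ) ^ p.val • (deRham n ∘ₗ lieDer p V) := by
  have hs : (-1 : ℝ) ^ p.val * (-1 : ℝ) ^ p.val = 1 := by
    rw [← mul_pow]; simp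
  refine TensorProduct.ext' fun f x => ?_
  simp only [LinearMap.comp_apply, LinearMap.smul_apply]
  have hQL : deRham n (lieDer p V (f ⊗ₜ[ℝ] x)) =
      ∑ α, ∑ γ, (MvPolynomial.X γ * f) ⊗ₜ[ℝ] (pd γ (V α) * pd α x) +
      (-1 : ℝ) ^ p.val • ∑ α, ∑ γ, (MvPolynomial.X γ * f) ⊗ₜ[ℝ] (V α * pd α (pd γ x)) +
      ∑ α, ∑ β, ∑ γ, (MvPolynomial.X γ * (MvPolynomial.X β * MvPolynomial.pderiv α f)) ⊗ₜ[ℝ]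
        (pd β (V α) * pd γ x) := by
    have h₁ (α γ : Fin n) : pd γ (V α * pd α x) =
        pd γ (V α) * pd α x + (-1 : ℝ) ^ p.val • (V α * pd α (pd γ x)) := by
      rw [pd_mul_of_mem_evenOdd (hV α), pd_pd_comm γ α, mul_neg, smul_neg, sub_neg_eq_add]
    simp only [lieDer_tmul, map_add, map_smul, map_sum, deRham_tmul, h₁,
      pd_pd_mul_of_mem_evenOdd (hV _), TensorProduct.tmul_add, TensorProduct.tmul_smul,
      Finset.sum_add_distrib, sum_X_mul_X_tmul_pd_pd_mul, ← Finset.smul_sum, smul_smul, hs,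
      one_smul, zero_add]
  have hLQ : lieDer p V (deRham n (f ⊗ₜ[ℝ] x)) =
      ∑ α, ∑ γ, (MvPolynomial.X γ * f) ⊗ₜ[ℝ] (V α * pd α (pd γ x)) +
      (-1 : ℝ) ^ p.val • (∑ α, ∑ γ, (MvPolynomial.X γ * f) ⊗ₜ[ℝ] (pd γ (V α) * pd α x) +
      ∑ α, ∑ β, ∑ γ, (MvPolynomial.X γ * (MvPolynomial.X β * MvPolynomial.pderiv α f)) ⊗ₜ[ℝ]
        (pd β (V α) * pd γ x)) := by
    have h₂ (α β γ : Fin n) : MvPolynomial.X β * MvPolynomial.pderiv α (MvPolynomial.X γ * f) =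
        (if γ = α then MvPolynomial.X β * f else 0) +
          MvPolynomial.X γ * (MvPolynomial.X β * MvPolynomial.pderiv α f) := by
      rw [Derivation.leibniz, MvPolynomial.pderiv_X, Pi.single_apply]
      simp only [smul_eq_mul]
      split_ifs <;> ring
    rw [deRham_tmul, map_sum]
    simp only [lieDer_tmul, h₂, TensorProduct.add_tmul, Finset.sum_add_distrib, ← Finset.smul_sum]
    refine congrArg₂ _ Finset.sum_comm (congrArg _ (congrArg₂ _ ?_ ?_))
    · rw [Finset.sum_comm]
      refine Finset.sum_congr rfl fun α _ => ?_
      rw [Finset.sum_comm]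
      refine Finset.sum_congr rfl fun β _ => ?_
      simp only [TensorProduct.ite_tmul, Finset.sum_ite_eq', Finset.mem_univ, if_true]
    · rw [Finset.sum_comm]
      exact Finset.sum_congr rfl fun α _ => Finset.sum_comm
  rw [hLQ, hQL]
  simp only [smul_add, smul_smul, hs, one_smul]
  abel
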